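/- arXiv:1710.00234 — 2 statements merged into one kernel-verified Lean document; each statement's English description precedes it below -/
import Mathlib

section
/- For every finite structure B over a finite relational signature σ, there exist k ≥ 1, nonzero rational numbers β₁,…,β_k, and pairwise non-isomorphic finite σ-structures B₁,…,B_k such that for every finite σ-structure A, Condens(A,B) = β₁ · hom(A,B₁) + ⋯ + β_k · hom(A,B_k). -/
/-- A finite relational signature: a finite set of relation symbols with arities. -/
structure Sig where
  symb : Type
  [fin : Finite symb]
  ar : symb → ℕ

attribute [instance] Sig.fin

/-- A finite structure over the signature `σ`. -/
structure Str (σ : Sig) where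
  carrier : Type
  [fin : Finite carrier]
  rel : ∀ R : σ.symb, Set (Fin (σ.ar R) → carrier)

attribute [instance] Str.fin

variable {σ : Sig}

/-- `h` is a homomorphism from `A` to `B`. -/
def IsHom (A B : Str σ) (h : A.carrier → B.carrier) : Prop :=
  ∀ R : σ.symb, ∀ t ∈ A.rel R, (h ∘ t) ∈ B.rel R

/-- `h` is a surjective homomorphism from `A` to `B`. -/
def IsSurjHom (A B : Str σ) (h : A.carrier → B.carrier) : Prop :=
  IsHom A B h ∧ Function.Surjective h

/-- `h` is a condensation from `A` to `B`. -/
def IsCondens (A B : Str σ) (h : A.carrier → B.carrier) : Prop :=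
  IsSurjHom A B h ∧ ∀ R : σ.symb, (fun t => h ∘ t) '' A.rel R = B.rel R

/-- The number of homomorphisms from `A` to `B`. -/
noncomputable def homCount (A B : Str σ) : ℕ := Nat.card {h : A.carrier → B.carrier // IsHom A B h}

/-- The number of surjective homomorphisms from `A` to `B`. -/
noncomputable def surjHomCount (A B : Str σ) : ℕ :=
  Nat.card {h : A.carrier → B.carrier // IsSurjHom A B h}

/-- The number of condensations from `A` to `B`. -/
noncomputable def condensCount (A B : Str σ) : ℕ :=
  Nat.card {h : A.carrier → B.carrier // IsCondens A B h}

/-- Isomorphism of structures. -/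
def Iso (A B : Str σ) : Prop :=
  ∃ e : A.carrier ≃ B.carrier, ∀ (R : σ.symb) (t : Fin (σ.ar R) → A.carrier),
    t ∈ A.rel R ↔ (⇑e ∘ t) ∈ B.rel R

/-- Homomorphic equivalence of structures. -/
def HomEquiv (A B : Str σ) : Prop :=
  (∃ h, IsHom A B h) ∧ (∃ h, IsHom B A h)

/-- The induced substructure of `B` on the subset `S`. -/
def induced (B : Str σ) (S : Set B.carrier) : Str σ where
  carrier := S
  rel R := {t | (fun i => (t i).val) ∈ B.rel R}

/-- The number of subsets `S` of the universe of `B` with `B[S]` isomorphic to `B'`. -/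
noncomputable def indsubCount (B' B : Str σ) : ℕ :=
  Nat.card {S : Set B.carrier // Iso (induced B S) B'}

/-- The deduct of `B` given by a family of subrelations `r`. -/
def deduct (B : Str σ) (r : ∀ R : σ.symb, Set (Fin (σ.ar R) → B.carrier)) : Str σ where
  carrier := B.carrier
  rel := r

/-- `C` is a deduct of `B`. -/
def IsDeductOf (C B : Str σ) : Prop :=
  ∃ r : ∀ R : σ.symb, Set (Fin (σ.ar R) → B.carrier),
    (∀ R, r R ⊆ B.rel R) ∧ C = deduct B r

/-- The number of deducts of `B` isomorphic to `B'`. -/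
noncomputable def deductsCount (B' B : Str σ) : ℕ :=
  Nat.card {r : ∀ R : σ.symb, Set (Fin (σ.ar R) → B.carrier) //
    (∀ R, r R ⊆ B.rel R) ∧ Iso (deduct B r) B'}

/-- The disjoint union of two structures. -/
def disjUnion (A₁ A₂ : Str σ) : Str σ where
  carrier := A₁.carrier ⊕ A₂.carrier
  rel R := (fun t => Sum.inl ∘ t) '' A₁.rel R ∪ (fun t => Sum.inr ∘ t) '' A₂.rel R

/-- The `N`-fold disjoint union of `A` with itself. -/
def nCopies (N : ℕ) (A : Str σ) : Str σ where
  carrier := Fin N × A.carrier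
  rel R := {t | ∃ j : Fin N, ∃ s ∈ A.rel R, t = fun i => (j, s i)}

/-- The total size of a structure: universe size plus sizes of all relations. -/
noncomputable def totalSize (B : Str σ) : ℕ :=
  Nat.card B.carrier + ∑ᶠ R : σ.symb, (B.rel R).ncard

theorem Iso.refl (A : Str σ) : Iso A A := ⟨Equiv.refl _, fun _ _ => Iff.rfl⟩

theorem Iso.symm {A B : Str σ} : Iso A B → Iso B A := by
  rintro ⟨e, he⟩
  refine ⟨e.symm, fun R t => ?_⟩
  rw [he, ← Function.comp_assoc, e.self_comp_symm, Function.id_comp]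

theorem Iso.trans {A B C : Str σ} : Iso A B → Iso B C → Iso A C := by
  rintro ⟨e, he⟩ ⟨f, hf⟩
  exact ⟨e.trans f, fun R t => (he R t).trans (hf R _)⟩

/-- Isomorphism as a setoid on the class of finite structures. -/
def isoSetoid (σ : Sig) : Setoid (Str σ) :=
  ⟨Iso, Iso.refl, Iso.symm, Iso.trans⟩

theorem Iso.homCount_eq {C D : Str σ} (h : Iso C D) (A : Str σ) :
    homCount A C = homCount A D := by
  obtain ⟨e, he⟩ := h
  exact Nat.card_congr ((Equiv.arrowCongr (Equiv.refl _) e).subtypeEquiv fun g =>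
    forall_congr' fun R => forall₂_congr fun t _ => he R (g ∘ t))

/-- A set of elements of `B` together with a family of relations on `B`. -/
abbrev SubData (B : Str σ) : Type :=
  Set B.carrier × ∀ R : σ.symb, Set (Fin (σ.ar R) → B.carrier)

/-- The universe and the relations of the homomorphic image of `A` under a map `h`. -/
def imageData (A B : Str σ) (h : A.carrier → B.carrier) : SubData B :=
  (Set.range h, fun R => (fun t => h ∘ t) '' A.rel R)

/-- The structure on the set `p.1` whose relations are those of `p.2` restricted to `p.1`. -/
def SubData.toStr {B : Str σ} (p : SubData B) : Str σ where
  carrier := p.1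
  rel R := {t | (fun i => (t i).val) ∈ p.2 R}

theorem imageData_le_iff {A B : Str σ} {h : A.carrier → B.carrier} {p : SubData B} :
    imageData A B h ≤ p ↔ (∀ a, h a ∈ p.1) ∧ ∀ R, ∀ t ∈ A.rel R, h ∘ t ∈ p.2 R := by
  simp only [imageData, Prod.le_def, Pi.le_def, Set.range_subset_iff,
    Set.image_subset_iff]
  rfl

theorem homCount_toStr (A : Str σ) {B : Str σ} (p : SubData B) :
    homCount A p.toStr = Nat.card {h : A.carrier → B.carrier // imageData A B h ≤ p} :=
  Nat.card_congr
    { toFun := fun g => ⟨fun a => (g.1 a).val,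
        imageData_le_iff.2 ⟨fun a => (g.1 a).2, g.2⟩⟩
      invFun := fun h => ⟨fun a => ⟨h.1 a, (imageData_le_iff.1 h.2).1 a⟩,
        (imageData_le_iff.1 h.2).2⟩
      left_inv := fun _ => rfl
      right_inv := fun _ => rfl }

theorem condensCount_eq_card_imageData (A B : Str σ) :
    condensCount A B =
      Nat.card {h : A.carrier → B.carrier // imageData A B h = (Set.univ, B.rel)} := by
  refine Nat.card_congr (Equiv.subtypeEquivRight fun h => ?_)
  simp only [imageData, Prod.mk.injEq, Set.range_eq_univ, funext_iff (f := fun R => _ '' _)]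
  refine ⟨fun H => ⟨H.1.2, H.2⟩, fun H => ⟨⟨fun R t ht => ?_, H.1⟩, H.2⟩⟩
  rw [← H.2 R]
  exact ⟨t, ht, rfl⟩

/-- Summing the fibres of `f` over a finite lower set counts the elements mapped into it. -/
theorem card_le_eq_card_eq_add_sum_lt {α P : Type*} [Finite α] [PartialOrder P] [Fintype P]
    [DecidableLT P] (f : α → P) (p : P) :
    Nat.card {a // f a ≤ p} =
      Nat.card {a // f a = p} + ∑ q with q < p, Nat.card {a // f a = q} := by
  classical
  have := Fintype.ofFinite α
  simp only [Nat.card_eq_fintype_card, Fintype.card_subtype]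
  rw [Finset.card_eq_sum_card_fiberwise (f := f) (t := insert p (Finset.univ.filter (· < p)))
    (fun a ha => by simpa [le_iff_eq_or_lt] using ha), Finset.sum_insert (by simp)]
  congr 1
  · congr 1
    ext a
    simpa using fun h : f a = p => h.le
  · refine Finset.sum_congr rfl fun q hq => ?_
    congr 1
    ext a
    simp only [Finset.mem_filter, Finset.mem_univ, true_and] at hq ⊢
    exact ⟨And.right, fun h => ⟨h.trans_le hq.le, h⟩⟩

/-- The span of the homomorphism-counting functions `hom(·, C)`. -/
def homSpan (σ : Sig) : Submodule ℚ (Str σ → ℚ) :=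
  Submodule.span ℚ (Set.range fun (C : Str σ) (A : Str σ) => (homCount A C : ℚ))

theorem card_imageData_mem_homSpan (B : Str σ) (p : SubData B) :
    (fun A : Str σ => (Nat.card {h : A.carrier → B.carrier // imageData A B h = p} : ℚ))
      ∈ homSpan σ := by
  classical
  have := Fintype.ofFinite (SubData B)
  induction p using WellFoundedLT.induction with
  | ind p ih =>
    have key : (fun A : Str σ =>
          (Nat.card {h : A.carrier → B.carrier // imageData A B h = p} : ℚ)) =
        (fun A => (homCount A p.toStr : ℚ)) - ∑ q with q < p, fun A : Str σ =>
          (Nat.card {h : A.carrier → B.carrier // imageData A B h = q} : ℚ) := by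
      funext A
      simp [homCount_toStr, card_le_eq_card_eq_add_sum_lt (imageData A B) p]
    rw [key]
    refine sub_mem (Submodule.subset_span ⟨p.toStr, rfl⟩) (sum_mem fun q hq => ih q ?_)
    simpa using hq

theorem condensCount_mem_homSpan (B : Str σ) :
    (fun A => (condensCount A B : ℚ)) ∈ homSpan σ := by
  simp only [condensCount_eq_card_imageData]
  exact card_imageData_mem_homSpan B _

theorem condensCount_self_ne_zero (B : Str σ) : condensCount B B ≠ 0 := by
  have : Nonempty {h : B.carrier → B.carrier // IsCondens B B h} :=
    ⟨id, ⟨fun _ _ ht => ht, Function.surjective_id⟩, fun _ => Set.image_id _⟩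
  exact Nat.card_ne_zero.2 ⟨this, inferInstance⟩

/-- Elements of `homSpan` are combinations of pairwise non-isomorphic structures. -/
theorem exists_sum_of_mem_homSpan {f : Str σ → ℚ} (hf : f ∈ homSpan σ) :
    ∃ (k : ℕ) (β : Fin k → ℚ) (Bs : Fin k → Str σ),
      (∀ i, β i ≠ 0) ∧ (∀ i j, i ≠ j → ¬ Iso (Bs i) (Bs j)) ∧
      ∀ A : Str σ, f A = ∑ i, β i * (homCount A (Bs i) : ℚ) := by
  have hrange : (Set.range fun (C : Str σ) (A : Str σ) => (homCount A C : ℚ)) ⊆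
      Set.range fun (q : Quotient (isoSetoid σ)) (A : Str σ) => (homCount A q.out : ℚ) := by
    rintro _ ⟨C, rfl⟩
    refine ⟨Quotient.mk _ C, funext fun A => ?_⟩
    have hC : Iso (Quotient.mk (isoSetoid σ) C).out C := Quotient.mk_out (s := isoSetoid σ) C
    simp only [hC.homCount_eq A]
  obtain ⟨c, rfl⟩ := Finsupp.mem_span_range_iff_exists_finsupp.1 (Submodule.span_mono hrange hf)
  let e := c.support.equivFin.symm
  refine ⟨c.support.card, fun i => c (e i), fun i => (e i).1.out,
    fun i => Finsupp.mem_support_iff.1 (e i).2, fun i j hij hiso => hij ?_, fun A => ?_⟩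
  · exact e.injective (Subtype.ext (Quotient.out_equiv_out.1 hiso))
  · rw [e.sum_comp fun q : c.support => c q * (homCount A q.1.out : ℚ),
      Finset.sum_coe_sort c.support fun q => c q * (homCount A q.out : ℚ)]
    simp [Finsupp.sum]

/-- Condens(·,B) is a linear combination of homomorphism-counting functions. -/
theorem stmt_7 (σ : Sig) (B : Str σ) :
    ∃ (k : ℕ) (β : Fin k → ℚ) (Bs : Fin k → Str σ),
      1 ≤ k ∧ (∀ i, β i ≠ 0) ∧ (∀ i j, i ≠ j → ¬ Iso (Bs i) (Bs j)) ∧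
      ∀ A : Str σ, (condensCount A B : ℚ) = ∑ i, β i * (homCount A (Bs i) : ℚ) := by
  obtain ⟨k, β, Bs, hβ, hBs, hsum⟩ := exists_sum_of_mem_homSpan (condensCount_mem_homSpan B)
  refine ⟨k, β, Bs, Nat.one_le_iff_ne_zero.2 ?_, hβ, hBs, hsum⟩
  rintro rfl
  exact condensCount_self_ne_zero B (by simpa using hsum B)
end

section
/- Let σ be a finite relational signature and let B₁,…,B_k be pairwise non-isomorphic finite σ-structures that are all pairwise homomorphically equivalent. Then there exists a finite σ-structure A such that the k values hom(A,B₁),…,hom(A,B_k) are all nonzero and pairwise distinct. -/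
variable {σ : Sig}

/-- The number of injective homomorphisms from `A` to `B`. -/
noncomputable def injHomCount (A B : Str σ) : ℕ :=
  Nat.card {h : A.carrier → B.carrier // IsHom A B h ∧ Function.Injective h}

theorem IsHom.comp {A B C : Str σ} {g : B.carrier → C.carrier} {f : A.carrier → B.carrier}
    (hg : IsHom B C g) (hf : IsHom A B f) : IsHom A C (g ∘ f) :=
  fun R t ht => hg R _ (hf R t ht)

theorem homCount_ne_zero_iff {A B : Str σ} : homCount A B ≠ 0 ↔ ∃ h, IsHom A B h := by
  rw [homCount, Nat.card_ne_zero, nonempty_subtype]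
  exact and_iff_left inferInstance

theorem homCount_disjUnion (A₁ A₂ B : Str σ) :
    homCount (disjUnion A₁ A₂) B = homCount A₁ B * homCount A₂ B := by
  rw [homCount, homCount, homCount, ← Nat.card_prod]
  refine Nat.card_congr
    { toFun := fun h => (⟨h.1 ∘ Sum.inl, fun R t ht => h.2 R _ (Or.inl ⟨t, ht, rfl⟩)⟩,
        ⟨h.1 ∘ Sum.inr, fun R t ht => h.2 R _ (Or.inr ⟨t, ht, rfl⟩)⟩)
      invFun := fun p => ⟨Sum.elim p.1.1 p.2.1, ?_⟩
      left_inv := ?_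
      right_inv := ?_ }
  · rintro R _ (⟨t, ht, rfl⟩ | ⟨t, ht, rfl⟩)
    · exact p.1.2 R t ht
    · exact p.2.2 R t ht
  · rintro ⟨h, hh⟩
    exact Subtype.ext (Sum.elim_comp_inl_inr h)
  · rintro ⟨⟨f, hf⟩, ⟨g, hg⟩⟩
    rfl

/-- The structure with empty universe and empty relations. -/
def emptyStr (σ : Sig) : Str σ where
  carrier := Empty
  rel _ := ∅

theorem homCount_emptyStr (B : Str σ) : homCount (emptyStr σ) B = 1 := by
  rw [homCount, Nat.card_eq_one_iff_unique]
  refine ⟨⟨fun f g => Subtype.ext (funext fun x => x.elim)⟩, ⟨⟨fun x => x.elim, ?_⟩⟩⟩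
  exact fun R t ht => ht.elim

theorem exists_homCount_eq_pow (A : Str σ) (N : ℕ) :
    ∃ C : Str σ, ∀ B, homCount C B = homCount A B ^ N := by
  induction N with
  | zero => exact ⟨emptyStr σ, fun B => by rw [homCount_emptyStr, pow_zero]⟩
  | succ N ih =>
    obtain ⟨C, hC⟩ := ih
    exact ⟨disjUnion C A, fun B => by rw [homCount_disjUnion, hC, pow_succ]⟩

/-- The quotient of a structure by an equivalence relation on its universe. -/
def quotientStr (A : Str σ) (s : Setoid A.carrier) : Str σ where
  carrier := Quotient s
  rel R := (fun t => Quotient.mk s ∘ t) '' A.rel R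

theorem card_homs_ker_eq (A B : Str σ) (s : Setoid A.carrier) :
    Nat.card {h : {h : A.carrier → B.carrier // IsHom A B h} // Setoid.ker h.1 = s} =
      injHomCount (quotientStr A s) B := by
  refine Nat.card_congr
    { toFun := fun h => ⟨Quotient.lift h.1.1 fun a b hab => ?_, ?_, ?_⟩
      invFun := fun g => ⟨⟨g.1 ∘ Quotient.mk s, fun R t ht => g.2.1 R _ ⟨t, ht, rfl⟩⟩, ?_⟩
      left_inv := ?_
      right_inv := ?_ }
  · have : Setoid.ker h.1.1 a b := by rw [h.2]; exact hab
    exact this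
  · rintro R _ ⟨t, ht, rfl⟩
    exact h.1.2 R t ht
  · rintro ⟨a⟩ ⟨b⟩ hab
    apply Quotient.sound
    have : Setoid.ker h.1.1 a b := hab
    rw [h.2] at this
    exact this
  · ext a b
    exact ⟨fun hab => Quotient.exact (g.2.2 hab), fun hab => congrArg g.1 (Quotient.sound hab)⟩
  · rintro ⟨⟨h, hh⟩, hk⟩
    rfl
  · rintro ⟨g, hg⟩
    apply Subtype.ext
    funext x
    induction x using Quotient.inductionOn
    rfl

theorem card_homs_ker_eq_bot (A B : Str σ) :
    Nat.card {h : {h : A.carrier → B.carrier // IsHom A B h} // Setoid.ker h.1 = ⊥} =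
      injHomCount A B := by
  refine Nat.card_congr ((Equiv.subtypeSubtypeEquivSubtypeInter _ (fun h => Setoid.ker h = ⊥)).trans
    (Equiv.subtypeEquivRight fun h => ?_))
  rw [Setoid.injective_iff_ker_bot]

open Classical in
theorem homCount_eq_injHomCount_add (A B : Str σ) [Fintype (Setoid A.carrier)] :
    homCount A B = injHomCount A B +
      ∑ s ∈ Finset.univ.erase (⊥ : Setoid A.carrier), injHomCount (quotientStr A s) B := by
  rw [homCount, ← Nat.card_congr (Equiv.sigmaFiberEquiv fun h :
    {h : A.carrier → B.carrier // IsHom A B h} => Setoid.ker h.1), Nat.card_sigma,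
    ← Finset.add_sum_erase _ _ (Finset.mem_univ ⊥), card_homs_ker_eq_bot]
  simp only [card_homs_ker_eq]

theorem card_quotient_lt {α : Type*} [Finite α] {s : Setoid α} (hs : s ≠ ⊥) :
    Nat.card (Quotient s) < Nat.card α := by
  refine lt_of_le_of_ne (Nat.card_le_card_of_surjective _ Quotient.mk_surjective) fun h => hs ?_
  have hb := (Nat.bijective_iff_surjective_and_card (Quotient.mk s)).2
    ⟨Quotient.mk_surjective, h.symm⟩
  ext a b
  exact ⟨fun hab => hb.1 (Quotient.sound hab), fun hab => hab ▸ s.refl a⟩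

theorem injHomCount_eq_of_homCount_eq {B B' : Str σ} (h : ∀ A, homCount A B = homCount A B')
    (A : Str σ) : injHomCount A B = injHomCount A B' := by
  classical
  induction hn : Nat.card A.carrier using Nat.strong_induction_on generalizing A with
  | _ n ih =>
    subst hn
    have : Finite (Setoid A.carrier) :=
      Finite.of_injective (fun s : Setoid A.carrier => s.r) fun s t hst =>
        Setoid.ext fun a b => iff_of_eq (congrFun₂ hst a b)
    have := Fintype.ofFinite (Setoid A.carrier)
    have hA := h A
    rw [homCount_eq_injHomCount_add, homCount_eq_injHomCount_add A B'] at hA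
    rw [Finset.sum_congr rfl fun s hs =>
      ih _ (card_quotient_lt (Finset.ne_of_mem_erase hs)) (quotientStr A s) rfl] at hA
    exact Nat.add_right_cancel hA

theorem exists_injective_isHom_of_homCount_eq {B B' : Str σ}
    (h : ∀ A, homCount A B = homCount A B') :
    ∃ f, IsHom B B' f ∧ Function.Injective f := by
  have hB : injHomCount B B ≠ 0 := by
    rw [injHomCount, Nat.card_ne_zero]
    exact ⟨⟨⟨id, fun R t ht => ht, Function.injective_id⟩⟩, inferInstance⟩
  rw [injHomCount_eq_of_homCount_eq h, injHomCount, Nat.card_ne_zero] at hB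
  obtain ⟨f⟩ := hB.1
  exact ⟨f.1, f.2⟩

theorem ncard_rel_le_of_injective {A B : Str σ} {f : A.carrier → B.carrier} (hf : IsHom A B f)
    (hinj : Function.Injective f) (R : σ.symb) : (A.rel R).ncard ≤ (B.rel R).ncard :=
  Set.ncard_le_ncard_of_injOn (fun t => f ∘ t) (hf R) (hinj.comp_left.injOn)

theorem iso_of_injective_isHom {A B : Str σ} {f : A.carrier → B.carrier}
    {g : B.carrier → A.carrier} (hf : IsHom A B f) (hfi : Function.Injective f)
    (hg : IsHom B A g) (hgi : Function.Injective g) : Iso A B := by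
  have hb : Function.Bijective f := (Nat.bijective_iff_injective_and_card f).2
    ⟨hfi, le_antisymm (Nat.card_le_card_of_injective f hfi) (Nat.card_le_card_of_injective g hgi)⟩
  refine ⟨Equiv.ofBijective f hb, fun R t => ⟨hf R t, fun ht => ?_⟩⟩
  have himg : (fun t => f ∘ t) '' A.rel R = B.rel R := by
    refine Set.eq_of_subset_of_ncard_le (Set.image_subset_iff.2 (hf R)) ?_
    rw [Set.ncard_image_of_injective _ hfi.comp_left]
    exact ncard_rel_le_of_injective hg hgi R
  have ht' : f ∘ t ∈ B.rel R := ht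
  rw [← himg] at ht'
  obtain ⟨u, hu, hut⟩ := ht'
  exact hfi.comp_left hut ▸ hu

theorem exists_homCount_ne_of_not_iso {B B' : Str σ} (h : ¬ Iso B B') :
    ∃ A, homCount A B ≠ homCount A B' := by
  by_contra! hall
  obtain ⟨f, hf, hfi⟩ := exists_injective_isHom_of_homCount_eq hall
  obtain ⟨g, hg, hgi⟩ := exists_injective_isHom_of_homCount_eq fun A => (hall A).symm
  exact h (iso_of_injective_isHom hf hfi hg hgi)

theorem eventually_pow_mul_lt_pow_mul {a b c d : ℕ} (hab : a < b) (hd : d ≠ 0) :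
    ∀ᶠ N in Filter.atTop, a ^ N * c < b ^ N * d := by
  have hb : (0 : ℝ) < b := by exact_mod_cast (Nat.zero_le a).trans_lt hab
  have hlim : Filter.Tendsto (fun N : ℕ => ((a : ℝ) / b) ^ N * c) Filter.atTop (nhds (0 * c)) :=
    (tendsto_pow_atTop_nhds_zero_of_lt_one (by positivity)
      ((div_lt_one hb).2 (by exact_mod_cast hab))).mul_const _
  rw [zero_mul] at hlim
  have hd' : (0 : ℝ) < d := by exact_mod_cast Nat.pos_of_ne_zero hd
  filter_upwards [hlim.eventually_lt_const hd'] with N hN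
  rw [div_pow, div_mul_eq_mul_div, div_lt_iff₀ (by positivity), mul_comm (d : ℝ)] at hN
  exact_mod_cast hN

theorem eventually_pow_mul_ne_pow_mul {a b c d : ℕ} (hc : c ≠ 0) (hd : d ≠ 0) (hab : a ≠ b) :
    ∀ᶠ N in Filter.atTop, a ^ N * c ≠ b ^ N * d := by
  rcases hab.lt_or_gt with h | h
  · exact (eventually_pow_mul_lt_pow_mul h hd).mono fun N hN => hN.ne
  · exact (eventually_pow_mul_lt_pow_mul h hc).mono fun N hN => hN.ne'

theorem exists_homCount_separating_both {ι : Type*} [Finite ι] (Bs : ι → Str σ) {A A' : Str σ}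
    (hA : ∀ i, homCount A (Bs i) ≠ 0) (hA' : ∀ i, homCount A' (Bs i) ≠ 0) :
    ∃ C : Str σ, (∀ i, homCount C (Bs i) ≠ 0) ∧ ∀ i j,
      (homCount A (Bs i) ≠ homCount A (Bs j) ∨ homCount A' (Bs i) ≠ homCount A' (Bs j)) →
        homCount C (Bs i) ≠ homCount C (Bs j) := by
  have hev : ∀ᶠ N in Filter.atTop, ∀ i j, homCount A (Bs i) ≠ homCount A (Bs j) →
      homCount A (Bs i) ^ N * homCount A' (Bs i) ≠ homCount A (Bs j) ^ N * homCount A' (Bs j) := by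
    simp only [Filter.eventually_all]
    exact fun i j hij => eventually_pow_mul_ne_pow_mul (hA' i) (hA' j) hij
  obtain ⟨N, hN⟩ := hev.exists
  obtain ⟨P, hP⟩ := exists_homCount_eq_pow A N
  refine ⟨disjUnion P A', fun i => ?_, fun i j hij => ?_⟩
  · rw [homCount_disjUnion, hP]
    exact mul_ne_zero (pow_ne_zero _ (hA i)) (hA' i)
  · rw [homCount_disjUnion, homCount_disjUnion, hP, hP]
    by_cases h : homCount A (Bs i) = homCount A (Bs j)
    · rw [h]
      exact fun heq => hij.resolve_left (not_not.2 h)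
        (Nat.eq_of_mul_eq_mul_left (Nat.pos_of_ne_zero (pow_ne_zero _ (hA j))) heq)
    · exact hN i j h

theorem exists_homCount_separating_pair {ι : Type*} (Bs : ι → Str σ)
    (hequiv : ∀ i j, HomEquiv (Bs i) (Bs j)) {i j : ι} (hij : ¬ Iso (Bs i) (Bs j)) :
    ∃ A : Str σ, (∀ l, homCount A (Bs l) ≠ 0) ∧ homCount A (Bs i) ≠ homCount A (Bs j) := by
  obtain ⟨A, hA⟩ := exists_homCount_ne_of_not_iso hij
  refine ⟨A, fun l => homCount_ne_zero_iff.2 ?_, hA⟩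
  obtain ⟨m, f, hf⟩ : ∃ m, ∃ f, IsHom A (Bs m) f := by
    by_cases hi : homCount A (Bs i) = 0
    · exact ⟨j, homCount_ne_zero_iff.1 fun hj => hA (hi.trans hj.symm)⟩
    · exact ⟨i, homCount_ne_zero_iff.1 hi⟩
  obtain ⟨g, hg⟩ := (hequiv m l).1
  exact ⟨g ∘ f, hg.comp hf⟩

/-- for pairwise non-isomorphic, pairwise homomorphically equivalent
templates, there is a structure A on which they have pairwise distinct nonzero
homomorphism counts. -/
theorem stmt_9 (σ : Sig) (k : ℕ) (Bs : Fin k → Str σ)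
    (hiso : ∀ i j, i ≠ j → ¬ Iso (Bs i) (Bs j))
    (hequiv : ∀ i j, HomEquiv (Bs i) (Bs j)) :
    ∃ A : Str σ, (∀ i, homCount A (Bs i) ≠ 0) ∧
      ∀ i j, i ≠ j → homCount A (Bs i) ≠ homCount A (Bs j) := by
  suffices h : ∀ P : Finset (Fin k × Fin k), ∃ A : Str σ, (∀ i, homCount A (Bs i) ≠ 0) ∧
      ∀ p ∈ P, p.1 ≠ p.2 → homCount A (Bs p.1) ≠ homCount A (Bs p.2) by
    obtain ⟨A, hA, hsep⟩ := h Finset.univ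
    exact ⟨A, hA, fun i j => hsep (i, j) (Finset.mem_univ _)⟩
  intro P
  induction P using Finset.induction_on with
  | empty => exact ⟨emptyStr σ, fun i => by simp [homCount_emptyStr], by simp⟩
  | insert p P _ ih =>
    obtain ⟨A, hA, hsep⟩ := ih
    by_cases hp : p.1 = p.2
    · refine ⟨A, hA, fun q hq hne => ?_⟩
      rcases Finset.mem_insert.1 hq with rfl | hq
      · exact absurd hp hne
      · exact hsep q hq hne
    · obtain ⟨A', hA', hsep'⟩ := exists_homCount_separating_pair Bs hequiv (hiso _ _ hp)
      obtain ⟨C, hC, hCsep⟩ := exists_homCount_separating_both Bs hA hA'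
      refine ⟨C, hC, fun q hq hne => hCsep _ _ ?_⟩
      rcases Finset.mem_insert.1 hq with rfl | hq
      · exact Or.inr hsep'
      · exact Or.inl (hsep q hq hne)
end
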